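/- Define the smoothing transform 𝔉_sm on Borel probability measures on [0,∞) as follows: 𝔉_sm μ is the pushforward of the product measure 𝔻 ⊗ Unif[0,1] ⊗ Unif[0,1] ⊗ μ ⊗ μ ⊗ μ under the map ((x,y),u,v,(d₁,d₂,d₃)) ↦ Σ_{k=1}^{3} √δ_k · d_k · 1{u ∈ I_k or v ∈ I_k}, where δ₁ = x, δ₂ = y, δ₃ = 1−x−y, I₁ = [0,δ₁), I₂ = [δ₁,δ₁+δ₂), I₃ = [δ₁+δ₂,1], and 𝔻 is the Dirichlet(1/2,1/2,1/2) distribution. Let μ₀ be any Borel probability measure on [0,∞) with ∫ x dμ₀(x) = √(π/2). Then the iterates 𝔉_sm^n μ₀ converge weakly, as n → ∞, to the Rayleigh distribution. -/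

import Mathlib

open MeasureTheory Real Set

/-- The Rayleigh distribution: density `x e^(−x²/2)` on `(0,∞)` w.r.t. Lebesgue. -/
noncomputable def rayleigh : Measure ℝ :=
  volume.withDensity fun x =>
    ENNReal.ofReal (Set.indicator (Set.Ioi (0 : ℝ)) (fun y => y * Real.exp (-y ^ 2 / 2)) x)

/-- The `Dirichlet(1/2,1/2,1/2)` distribution on `ℝ²`: density
`(2π)⁻¹ (xy(1−x−y))^(−1/2)` on the open simplex w.r.t. 2-dim Lebesgue. -/
noncomputable def dirichletHalf : Measure (ℝ × ℝ) :=
  volume.withDensity fun p =>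
    ENNReal.ofReal
      (Set.indicator {q : ℝ × ℝ | 0 < q.1 ∧ 0 < q.2 ∧ q.1 + q.2 < 1}
        (fun q => (2 * π)⁻¹ * (q.1 * q.2 * (1 - q.1 - q.2)) ^ (-(1 / 2) : ℝ)) p)

/-- The uniform distribution on `[0,1]`. -/
noncomputable def unif01 : Measure ℝ := volume.restrict (Set.Icc (0 : ℝ) 1)

/-- The map `((x,y),u,v,(d₁,d₂,d₃)) ↦ Σₖ √δₖ · dₖ · 1{u ∈ Iₖ or v ∈ Iₖ}` where
`δ₁ = x`, `δ₂ = y`, `δ₃ = 1−x−y`, `I₁ = [0,δ₁)`, `I₂ = [δ₁,δ₁+δ₂)`, `I₃ = [δ₁+δ₂,1]`. -/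
noncomputable def smoothingMap : (ℝ × ℝ) × ℝ × ℝ × ℝ × ℝ × ℝ → ℝ := fun q =>
  let δ₁ := q.1.1
  let δ₂ := q.1.2
  let δ₃ := 1 - q.1.1 - q.1.2
  let u := q.2.1
  let v := q.2.2.1
  let d₁ := q.2.2.2.1
  let d₂ := q.2.2.2.2.1
  let d₃ := q.2.2.2.2.2
  Real.sqrt δ₁ * d₁ * (if u ∈ Set.Ico (0 : ℝ) δ₁ ∨ v ∈ Set.Ico (0 : ℝ) δ₁ then 1 else 0) +
  Real.sqrt δ₂ * d₂ * (if u ∈ Set.Ico δ₁ (δ₁ + δ₂) ∨ v ∈ Set.Ico δ₁ (δ₁ + δ₂) then 1 else 0) +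
  Real.sqrt δ₃ * d₃ * (if u ∈ Set.Icc (δ₁ + δ₂) 1 ∨ v ∈ Set.Icc (δ₁ + δ₂) 1 then 1 else 0)

/-- The smoothing transform `𝔉_sm` associated with the BCRT: the law of
`Σₖ √Δₖ Dₖ 1{Pₖ>0}` where `(Δ₁,Δ₂,Δ₃) ~ Dirichlet(1/2,1/2,1/2)`, `D₁,D₂,D₃` i.i.d.
with law `μ`, and, conditionally on `Δ`, `(P₁,P₂,P₃) ~ Multinomial(2;Δ₁,Δ₂,Δ₃)`,
realised via two independent uniforms `u,v` on `[0,1]`. -/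
noncomputable def Fsm (μ : Measure ℝ) : Measure ℝ :=
  Measure.map smoothingMap
    (dirichletHalf.prod (unif01.prod (unif01.prod (μ.prod (μ.prod μ)))))

open Filter Topology

open MeasureTheory Real Set
open Filter Topology

lemma beta_scaled {p q c : ℝ} (hp : 0 < p) (hq : 0 < q) (hc : 0 < c) :
    ∫⁻ x in Ioo 0 c, ENNReal.ofReal (x ^ (p - 1) * (c - x) ^ (q - 1)) =
      ENNReal.ofReal (c ^ (p + q - 1) * ProbabilityTheory.beta p q) := by
  have hB := ProbabilityTheory.beta_pos hp hq
  have h1 : ∫⁻ x in Ioo (0:ℝ) 1, ENNReal.ofReal (x ^ (p - 1) * (1 - x) ^ (q - 1)) =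
      ENNReal.ofReal (ProbabilityTheory.beta p q) := by
    have h := ProbabilityTheory.lintegral_betaPDF_eq_one hp hq
    rw [ProbabilityTheory.lintegral_betaPDF] at h
    have : ∀ x : ℝ, ENNReal.ofReal (x ^ (p - 1) * (1 - x) ^ (q - 1)) =
        ENNReal.ofReal (ProbabilityTheory.beta p q) * ENNReal.ofReal
          (1 / ProbabilityTheory.beta p q * x ^ (p - 1) * (1 - x) ^ (q - 1)) := by
      intro x
      rw [← ENNReal.ofReal_mul hB.le]
      congr 1
      field_simp
    simp_rw [this]
    rw [lintegral_const_mul _ (by fun_prop), h, mul_one]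
  have him : (fun x => c * x) '' Ioo (0:ℝ) 1 = Ioo 0 c := by
    rw [Set.image_mul_left_Ioo hc]; simp
  rw [← him, lintegral_image_eq_lintegral_abs_deriv_mul (f' := fun _ => c) measurableSet_Ioo
    (fun x _ => by simpa using ((hasDerivAt_id x).const_mul c).hasDerivWithinAt)
    (fun x _ y _ h => mul_left_cancel₀ hc.ne' h)]
  rw [ENNReal.ofReal_mul (by positivity), ← h1, ← lintegral_const_mul _ (by fun_prop)]
  refine setLIntegral_congr_fun measurableSet_Ioo fun x hx => ?_
  have hx1 : 0 ≤ 1 - x := by linarith [hx.2]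
  have hx0 : 0 ≤ x := hx.1.le
  rw [← ENNReal.ofReal_mul (abs_nonneg _), ← ENNReal.ofReal_mul (by positivity)]
  congr 1
  rw [show c - c * x = c * (1 - x) by ring, mul_rpow hc.le hx0, mul_rpow hc.le hx1, abs_of_pos hc,
    show p + q - 1 = 1 + (p - 1) + (q - 1) by ring, rpow_add hc, rpow_add hc, rpow_one]
  ring

lemma simplex_meas : MeasurableSet {q : ℝ × ℝ | 0 < q.1 ∧ 0 < q.2 ∧ q.1 + q.2 < 1} := by
  measurability

lemma dirichlet_dens_meas : Measurable fun p : ℝ × ℝ =>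
    ENNReal.ofReal
      (Set.indicator {q : ℝ × ℝ | 0 < q.1 ∧ 0 < q.2 ∧ q.1 + q.2 < 1}
        (fun q => (2 * π)⁻¹ * (q.1 * q.2 * (1 - q.1 - q.2)) ^ (-(1 / 2) : ℝ)) p) := by
  refine ENNReal.measurable_ofReal.comp (Measurable.indicator (by fun_prop) simplex_meas)

lemma dirichlet_ae : ∀ᵐ p ∂dirichletHalf, 0 < p.1 ∧ 0 < p.2 ∧ p.1 + p.2 < 1 := by
  unfold dirichletHalf
  rw [ae_withDensity_iff dirichlet_dens_meas]
  refine Filter.Eventually.of_forall fun p hp => ?_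
  by_contra h
  apply hp
  rw [Set.indicator_of_notMem (by exact h)]
  simp

lemma dirichlet_moment {a b c : ℝ} (ha : 0 ≤ a) (hb : 0 ≤ b) (hc : 0 ≤ c) :
    ∫⁻ z, ENNReal.ofReal (z.1 ^ a * z.2 ^ b * (1 - z.1 - z.2) ^ c) ∂dirichletHalf =
      ENNReal.ofReal ((2 * π)⁻¹ * (Gamma (a + 1 / 2) * Gamma (b + 1 / 2) * Gamma (c + 1 / 2))
        / Gamma (a + b + c + 3 / 2)) := by
  unfold dirichletHalf
  rw [lintegral_withDensity_eq_lintegral_mul _ dirichlet_dens_meas (by fun_prop)]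
  rw [Measure.volume_eq_prod, lintegral_prod _ (by
    exact (dirichlet_dens_meas.mul (by fun_prop)).aemeasurable)]
  have hinner : ∀ x : ℝ, (∫⁻ y : ℝ, ((fun p : ℝ × ℝ =>
    ENNReal.ofReal
      (Set.indicator {q : ℝ × ℝ | 0 < q.1 ∧ 0 < q.2 ∧ q.1 + q.2 < 1}
        (fun q => (2 * π)⁻¹ * (q.1 * q.2 * (1 - q.1 - q.2)) ^ (-(1 / 2) : ℝ)) p)) *
      fun z : ℝ × ℝ => ENNReal.ofReal (z.1 ^ a * z.2 ^ b * (1 - z.1 - z.2) ^ c)) (x, y)) =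
      (Ioo (0:ℝ) 1).indicator (fun x =>
        ENNReal.ofReal ((2 * π)⁻¹ * ProbabilityTheory.beta (b + 1 / 2) (c + 1 / 2)) *
        ENNReal.ofReal (x ^ (a + 1 / 2 - 1) * (1 - x) ^ (b + c + 1 - 1))) x := by
    intro x
    by_cases hx : x ∈ Ioo (0:ℝ) 1
    · rw [Set.indicator_of_mem hx]
      have hx0 : 0 < x := hx.1
      have hx1 : 0 < 1 - x := by linarith [hx.2]
      have hB := ProbabilityTheory.beta_pos (show 0 < b + 1 / 2 by linarith)
        (show 0 < c + 1 / 2 by linarith)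
      rw [← ENNReal.ofReal_mul (by positivity)]
      have h2 := beta_scaled (p := b + 1 / 2) (q := c + 1 / 2) (by linarith) (by linarith) hx1
      have h3 : ENNReal.ofReal ((2 * π)⁻¹ * ProbabilityTheory.beta (b + 1 / 2) (c + 1 / 2) *
          (x ^ (a + 1 / 2 - 1) * (1 - x) ^ (b + c + 1 - 1))) =
          ENNReal.ofReal ((2 * π)⁻¹ * x ^ (a + 1 / 2 - 1)) *
          ∫⁻ y in Ioo 0 (1 - x), ENNReal.ofReal (y ^ (b + 1/2 - 1) * (1 - x - y) ^ (c + 1/2 - 1)) := by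
        rw [h2, ← ENNReal.ofReal_mul (by positivity)]
        congr 1
        rw [show b + 1/2 + (c + 1/2) - 1 = b + c + 1 - 1 by ring]
        ring
      rw [h3, ← lintegral_const_mul _ (by fun_prop), ← lintegral_indicator measurableSet_Ioo]
      refine lintegral_congr fun y => ?_
      by_cases hy : y ∈ Ioo 0 (1 - x)
      · rw [Set.indicator_of_mem hy]
        have hy0 : 0 < y := hy.1
        have hy1 : 0 < 1 - x - y := by linarith [hy.2]
        simp only [Pi.mul_apply]
        rw [Set.indicator_of_mem (by exact ⟨hx0, hy0, by linarith⟩),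
          ← ENNReal.ofReal_mul (by positivity), ← ENNReal.ofReal_mul (by positivity)]
        congr 1
        simp only
        rw [mul_rpow (by positivity) hy1.le, mul_rpow hx0.le hy0.le,
          show a + 1/2 - 1 = -(1/2) + a by ring, show b + 1/2 - 1 = -(1/2) + b by ring,
          show c + 1/2 - 1 = -(1/2) + c by ring, rpow_add hx0, rpow_add hy0, rpow_add hy1]
        ring
      · rw [Set.indicator_of_notMem hy]
        simp only [Pi.mul_apply]
        rw [Set.indicator_of_notMem]
        · simp
        · rintro ⟨h1, h2, h3⟩
          exact hy ⟨h2, by simp only at h3; linarith⟩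
    · rw [Set.indicator_of_notMem hx]
      rw [lintegral_eq_zero_iff (by
        exact (dirichlet_dens_meas.mul (by fun_prop)).comp (measurable_const.prodMk measurable_id))]
      refine Filter.Eventually.of_forall fun y => ?_
      simp only [Pi.mul_apply]
      rw [Set.indicator_of_notMem]
      · simp
      · rintro ⟨h1, h2, h3⟩
        exact hx ⟨h1, by simp only at h1 h2 h3; linarith⟩
  simp_rw [hinner]
  rw [lintegral_indicator measurableSet_Ioo, lintegral_const_mul _ (by fun_prop),
    beta_scaled (by linarith) (by linarith) one_pos, ← ENNReal.ofReal_mul]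
  · congr 1
    unfold ProbabilityTheory.beta
    rw [show b + 1/2 + (c + 1/2) = b + c + 1 by ring,
      show a + 1/2 + (b + c + 1) = a + b + c + 3/2 by ring, one_rpow]
    have : Gamma (b + c + 1) ≠ 0 := (Gamma_pos_of_pos (by linarith)).ne'
    field_simp
  · have hB := ProbabilityTheory.beta_pos (show 0 < b + 1 / 2 by linarith)
        (show 0 < c + 1 / 2 by linarith)
    positivity

instance : IsProbabilityMeasure dirichletHalf := by
  constructor
  have h := dirichlet_moment le_rfl le_rfl (le_refl (0:ℝ))
  simp only [rpow_zero, mul_one, ENNReal.ofReal_one, lintegral_one, zero_add] at h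
  rw [h, ENNReal.ofReal_eq_one]
  rw [show (3/2 : ℝ) = 1/2 + 1 by norm_num, Gamma_add_one (by norm_num), Real.Gamma_one_half_eq]
  have : 0 < √π := by positivity
  field_simp
  rw [Real.sq_sqrt pi_pos.le]

instance : IsProbabilityMeasure unif01 := by
  constructor
  simp [unif01]

open MeasureTheory Real Set
open Filter Topology

/-- first weight -/
noncomputable def wT1 (w : (ℝ × ℝ) × ℝ × ℝ) : ℝ :=
  Real.sqrt w.1.1 *
    (if w.2.1 ∈ Set.Ico (0 : ℝ) w.1.1 ∨ w.2.2 ∈ Set.Ico (0 : ℝ) w.1.1 then 1 else 0)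

/-- second weight -/
noncomputable def wT2 (w : (ℝ × ℝ) × ℝ × ℝ) : ℝ :=
  Real.sqrt w.1.2 *
    (if w.2.1 ∈ Set.Ico w.1.1 (w.1.1 + w.1.2) ∨ w.2.2 ∈ Set.Ico w.1.1 (w.1.1 + w.1.2)
      then 1 else 0)

/-- third weight -/
noncomputable def wT3 (w : (ℝ × ℝ) × ℝ × ℝ) : ℝ :=
  Real.sqrt (1 - w.1.1 - w.1.2) *
    (if w.2.1 ∈ Set.Icc (w.1.1 + w.1.2) 1 ∨ w.2.2 ∈ Set.Icc (w.1.1 + w.1.2) 1 then 1 else 0)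

/-- law of the randomness driving the weights -/
noncomputable def omg : Measure ((ℝ × ℝ) × ℝ × ℝ) := dirichletHalf.prod (unif01.prod unif01)

instance : IsProbabilityMeasure omg := by unfold omg; infer_instance

@[fun_prop]
lemma wT1_meas : Measurable wT1 := by
  unfold wT1
  refine Measurable.mul (by fun_prop) (Measurable.ite ?_ measurable_const measurable_const)
  simp only [mem_Ico]
  measurability

@[fun_prop]
lemma wT2_meas : Measurable wT2 := by
  unfold wT2
  refine Measurable.mul (by fun_prop) (Measurable.ite ?_ measurable_const measurable_const)
  simp only [mem_Ico]
  measurability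

@[fun_prop]
lemma wT3_meas : Measurable wT3 := by
  unfold wT3
  refine Measurable.mul (by fun_prop) (Measurable.ite ?_ measurable_const measurable_const)
  simp only [mem_Icc]
  measurability

lemma wT_nonneg (w) : 0 ≤ wT1 w ∧ 0 ≤ wT2 w ∧ 0 ≤ wT3 w := by
  unfold wT1 wT2 wT3
  refine ⟨?_, ?_, ?_⟩ <;> positivity

/-- the map driven by weights -/
noncomputable def smap (q : ((ℝ × ℝ) × ℝ × ℝ) × ℝ × ℝ × ℝ) : ℝ :=
  wT1 q.1 * q.2.1 + wT2 q.1 * q.2.2.1 + wT3 q.1 * q.2.2.2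

@[fun_prop]
lemma smap_meas : Measurable smap := by unfold smap; fun_prop

lemma smoothing_eq (q : (ℝ × ℝ) × ℝ × ℝ × ℝ × ℝ × ℝ) :
    smoothingMap q = smap ((q.1, q.2.1, q.2.2.1), q.2.2.2) := by
  unfold smoothingMap smap wT1 wT2 wT3
  simp only
  ring

lemma smoothing_meas : Measurable smoothingMap := by
  have : smoothingMap = fun q => smap ((q.1, q.2.1, q.2.2.1), q.2.2.2) :=
    funext smoothing_eq
  rw [this]
  fun_prop

lemma Fsm_eq (μ : Measure ℝ) [IsProbabilityMeasure μ] :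
    Fsm μ = Measure.map smap (omg.prod (μ.prod (μ.prod μ))) := by
  unfold Fsm
  have h1 : dirichletHalf.prod (unif01.prod (unif01.prod (μ.prod (μ.prod μ)))) =
      Measure.map (fun q : ((ℝ × ℝ) × ℝ × ℝ) × ℝ × ℝ × ℝ => (q.1.1, q.1.2.1, q.1.2.2, q.2))
        (omg.prod (μ.prod (μ.prod μ))) := by
    unfold omg
    rw [← Measure.prodAssoc_prod (μ := unif01) (ν := unif01)]
    conv_lhs => enter [1]; rw [← Measure.map_id (μ := dirichletHalf)]
    rw [Measure.map_prod_map _ _ measurable_id (MeasurableEquiv.measurable _),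
      ← Measure.prodAssoc_prod, Measure.map_map (by fun_prop) (by fun_prop)]
    rfl
  rw [h1, Measure.map_map smoothing_meas (by fun_prop)]
  congr 1
  funext q
  simp [smoothing_eq]

instance Fsm_prob (μ : Measure ℝ) [IsProbabilityMeasure μ] : IsProbabilityMeasure (Fsm μ) := by
  rw [Fsm_eq]
  exact Measure.isProbabilityMeasure_map (by fun_prop)

lemma Fsm_charFun (μ : Measure ℝ) [IsProbabilityMeasure μ] (t : ℝ) :
    charFun (Fsm μ) t = ∫ w, charFun μ (wT1 w * t) * charFun μ (wT2 w * t) *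
      charFun μ (wT3 w * t) ∂omg := by
  rw [charFun_apply_real, Fsm_eq, integral_map (by fun_prop) (by fun_prop), integral_prod]
  · refine integral_congr_ae (Filter.Eventually.of_forall fun w => ?_)
    simp only [smap]
    have : ∀ d : ℝ × ℝ × ℝ, Complex.exp (t * ((wT1 w * d.1 + wT2 w * d.2.1 + wT3 w * d.2.2 : ℝ) : ℂ)
        * Complex.I) = Complex.exp ((wT1 w * t : ℝ) * d.1 * Complex.I) *
          (Complex.exp ((wT2 w * t : ℝ) * d.2.1 * Complex.I) *
            Complex.exp ((wT3 w * t : ℝ) * d.2.2 * Complex.I)) := by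
      intro d
      rw [← Complex.exp_add, ← Complex.exp_add]
      congr 1
      push_cast
      ring
    simp_rw [this]
    rw [integral_prod_mul (fun x : ℝ => Complex.exp ((wT1 w * t : ℝ) * x * Complex.I))
      (fun e : ℝ × ℝ => (Complex.exp ((wT2 w * t : ℝ) * e.1 * Complex.I) *
            Complex.exp ((wT3 w * t : ℝ) * e.2 * Complex.I))),
      integral_prod_mul (fun x : ℝ => Complex.exp ((wT2 w * t : ℝ) * x * Complex.I))
        (fun x : ℝ => Complex.exp ((wT3 w * t : ℝ) * x * Complex.I)),
      charFun_apply_real, charFun_apply_real, charFun_apply_real, mul_assoc]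
  · refine (integrable_const (1:ℝ)).mono' (by fun_prop) (Filter.Eventually.of_forall fun q => ?_)
    rw [← Complex.ofReal_mul, Complex.norm_exp_ofReal_mul_I]

/-- moment generating function, as a lower integral -/
noncomputable def mgl (μ : Measure ℝ) (t : ℝ) : ENNReal := ∫⁻ x, ENNReal.ofReal (exp (t * x)) ∂μ

@[fun_prop]
lemma mgl_meas (μ : Measure ℝ) [SFinite μ] : Measurable (mgl μ) := by
  unfold mgl
  exact Measurable.lintegral_prod_right' (f := fun z : ℝ × ℝ => ENNReal.ofReal (exp (z.1 * z.2)))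
    (by fun_prop)

lemma Fsm_mgl (μ : Measure ℝ) [IsProbabilityMeasure μ] (t : ℝ) :
    mgl (Fsm μ) t = ∫⁻ w, mgl μ (wT1 w * t) * mgl μ (wT2 w * t) * mgl μ (wT3 w * t) ∂omg := by
  unfold mgl
  rw [Fsm_eq, lintegral_map (by fun_prop) (by fun_prop), lintegral_prod _ (by fun_prop)]
  refine lintegral_congr fun w => ?_
  simp only [smap]
  have : ∀ d : ℝ × ℝ × ℝ, ENNReal.ofReal (exp (t * (wT1 w * d.1 + wT2 w * d.2.1 + wT3 w * d.2.2)))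
      = ENNReal.ofReal (exp (wT1 w * t * d.1)) * (ENNReal.ofReal (exp (wT2 w * t * d.2.1)) *
          ENNReal.ofReal (exp (wT3 w * t * d.2.2))) := by
    intro d
    rw [← ENNReal.ofReal_mul (exp_pos _).le, ← ENNReal.ofReal_mul (exp_pos _).le, ← exp_add,
      ← exp_add]
    congr 2
    ring
  simp_rw [this]
  rw [lintegral_prod_mul (f := fun x : ℝ => ENNReal.ofReal (exp (wT1 w * t * x)))
      (g := fun e : ℝ × ℝ => (ENNReal.ofReal (exp (wT2 w * t * e.1)) *
          ENNReal.ofReal (exp (wT3 w * t * e.2)))) (by fun_prop) (by fun_prop),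
      lintegral_prod_mul (f := fun x : ℝ => ENNReal.ofReal (exp (wT2 w * t * x)))
        (g := fun x : ℝ => ENNReal.ofReal (exp (wT3 w * t * x))) (by fun_prop) (by fun_prop),
      mul_assoc]

lemma unif_lint {x y : ℝ} (h : 0 < x ∧ 0 < y ∧ x + y < 1) (g : ℝ → ENNReal) (c1 c2 c3 : ENNReal)
    (h1 : ∀ u ∈ Ico 0 x, g u = c1) (h2 : ∀ u ∈ Ico x (x + y), g u = c2)
    (h3 : ∀ u ∈ Icc (x + y) 1, g u = c3) :
    ∫⁻ u, g u ∂unif01 = ENNReal.ofReal x * c1 + ENNReal.ofReal y * c2 +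
      ENNReal.ofReal (1 - x - y) * c3 := by
  obtain ⟨hx, hy, hxy⟩ := h
  unfold unif01
  have e : Icc (0:ℝ) 1 = (Ico 0 x ∪ Ico x (x + y)) ∪ Icc (x + y) 1 := by
    rw [Ico_union_Ico_eq_Ico hx.le (by linarith), Ico_union_Icc_eq_Icc (by linarith) hxy.le]
  rw [e, lintegral_union measurableSet_Icc, lintegral_union measurableSet_Ico,
    setLIntegral_congr_fun measurableSet_Ico h1, setLIntegral_congr_fun measurableSet_Ico h2,
    setLIntegral_congr_fun measurableSet_Icc h3]
  · simp only [lintegral_const, Measure.restrict_apply, MeasurableSet.univ, univ_inter,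
      Real.volume_Ico, Real.volume_Icc]
    rw [show x - 0 = x by ring, show x + y - x = y by ring, show 1 - (x + y) = 1 - x - y by ring]
    simp only [mul_comm]
  · exact Set.disjoint_left.2 fun a ha hb => by simp at ha hb; linarith
  · exact Set.disjoint_left.2 fun a ha hb => by
      simp at ha hb
      rcases ha with ha | ha <;> linarith

lemma omg_lint (G : ℝ → ℝ → ℝ → ENNReal)
    (hG : Measurable fun z : ℝ × ℝ × ℝ => G z.1 z.2.1 z.2.2) :
    ∫⁻ w, G (wT1 w) (wT2 w) (wT3 w) ∂omg =
      ∫⁻ p, (ENNReal.ofReal (p.1 ^ 2) * G √p.1 0 0 + ENNReal.ofReal (p.2 ^ 2) * G 0 √p.2 0 +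
        ENNReal.ofReal ((1 - p.1 - p.2) ^ 2) * G 0 0 √(1 - p.1 - p.2)
        + 2 * ENNReal.ofReal (p.1 * p.2) * G √p.1 √p.2 0
        + 2 * ENNReal.ofReal (p.1 * (1 - p.1 - p.2)) * G √p.1 0 √(1 - p.1 - p.2)
        + 2 * ENNReal.ofReal (p.2 * (1 - p.1 - p.2)) * G 0 √p.2 √(1 - p.1 - p.2)) ∂dirichletHalf := by
  unfold omg
  have hm : Measurable fun w => G (wT1 w) (wT2 w) (wT3 w) :=
    hG.comp (g := fun z : ℝ × ℝ × ℝ => G z.1 z.2.1 z.2.2)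
      (f := fun w => (wT1 w, wT2 w, wT3 w)) (by fun_prop)
  rw [lintegral_prod _ hm.aemeasurable]
  refine lintegral_congr_ae ?_
  filter_upwards [dirichlet_ae] with p hp
  rw [lintegral_prod _ (by
    exact (hm.comp (measurable_const.prodMk measurable_id)).aemeasurable)]
  obtain ⟨x, y⟩ := p
  simp only at hp
  obtain ⟨hx, hy, hxy⟩ := hp
  have hz : 0 < 1 - x - y := by linarith
  have k1 : ∀ u, u ∈ Ico 0 x → u ∉ Ico x (x + y) ∧ u ∉ Icc (x + y) 1 := by
    intro u hu
    simp only [mem_Ico, mem_Icc, not_and_or, not_le, not_lt] at *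
    exact ⟨Or.inl (by linarith), Or.inl (by linarith)⟩
  have k2 : ∀ u, u ∈ Ico x (x + y) → u ∉ Ico 0 x ∧ u ∉ Icc (x + y) 1 := by
    intro u hu
    simp only [mem_Ico, mem_Icc, not_and_or, not_le, not_lt] at *
    exact ⟨Or.inr (by linarith), Or.inl (by linarith)⟩
  have k3 : ∀ u, u ∈ Icc (x + y) 1 → u ∉ Ico 0 x ∧ u ∉ Ico x (x + y) := by
    intro u hu
    simp only [mem_Ico, mem_Icc, not_and_or, not_le, not_lt] at *
    exact ⟨Or.inr (by linarith), Or.inr (by linarith)⟩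
  rw [unif_lint ⟨hx, hy, hxy⟩ _
    (ENNReal.ofReal x * G √x 0 0 + ENNReal.ofReal y * G √x √y 0
      + ENNReal.ofReal (1 - x - y) * G √x 0 √(1 - x - y))
    (ENNReal.ofReal x * G √x √y 0 + ENNReal.ofReal y * G 0 √y 0
      + ENNReal.ofReal (1 - x - y) * G 0 √y √(1 - x - y))
    (ENNReal.ofReal x * G √x 0 √(1 - x - y) + ENNReal.ofReal y * G 0 √y √(1 - x - y)
      + ENNReal.ofReal (1 - x - y) * G 0 0 √(1 - x - y))]
  · simp only
    rw [ENNReal.ofReal_mul hx.le, ENNReal.ofReal_mul hx.le, ENNReal.ofReal_mul hy.le,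
      ENNReal.ofReal_pow hx.le, ENNReal.ofReal_pow hy.le, ENNReal.ofReal_pow hz.le]
    ring
  · intro u hu
    refine unif_lint ⟨hx, hy, hxy⟩ _ _ _ _ ?_ ?_ ?_ <;> intro v hv <;>
      simp only [wT1, wT2, wT3, hu, hv, k1 u hu, k1 v, k2 v, k3 v, or_true, true_or, or_false, if_true, if_false,
        mul_one, mul_zero]
  · intro u hu
    refine unif_lint ⟨hx, hy, hxy⟩ _ _ _ _ ?_ ?_ ?_ <;> intro v hv <;>
      simp only [wT1, wT2, wT3, hu, hv, k2 u hu, k1 v, k2 v, k3 v, or_true, true_or, or_false, if_true, if_false,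
        mul_one, mul_zero]
  · intro u hu
    refine unif_lint ⟨hx, hy, hxy⟩ _ _ _ _ ?_ ?_ ?_ <;> intro v hv <;>
      simp only [wT1, wT2, wT3, hu, hv, k3 u hu, k1 v, k2 v, k3 v, or_true, true_or, or_false, if_true, if_false,
        mul_one, mul_zero]

open MeasureTheory Real Set
open Filter Topology

lemma ray_dens_meas : Measurable fun x : ℝ =>
    ENNReal.ofReal (Set.indicator (Set.Ioi (0 : ℝ)) (fun y => y * Real.exp (-y ^ 2 / 2)) x) :=
  ENNReal.measurable_ofReal.comp (Measurable.indicator (by fun_prop) measurableSet_Ioi)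

lemma ray_lint (g : ℝ → ENNReal) (hg : Measurable g) :
    ∫⁻ x, g x ∂rayleigh = ∫⁻ x in Ioi 0, ENNReal.ofReal (x * exp (-x ^ 2 / 2)) * g x := by
  unfold rayleigh
  rw [lintegral_withDensity_eq_lintegral_mul _ ray_dens_meas hg,
    ← lintegral_indicator measurableSet_Ioi]
  refine lintegral_congr fun x => ?_
  by_cases hx : x ∈ Ioi (0:ℝ)
  · simp only [Pi.mul_apply, Set.indicator_of_mem hx]
  · simp only [Pi.mul_apply, Set.indicator_of_notMem hx]
    simp

lemma ray_ae : ∀ᵐ x ∂rayleigh, 0 < x := by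
  unfold rayleigh
  rw [ae_withDensity_iff ray_dens_meas]
  refine Filter.Eventually.of_forall fun p hp => ?_
  by_contra h
  apply hp
  rw [Set.indicator_of_notMem (by exact h)]
  simp

/-- Taylor coefficients of the Rayleigh moment generating function -/
noncomputable def aR (m : ℕ) : ℝ := 2 ^ ((m : ℝ) / 2) * Gamma (1 + m / 2) / m.factorial

lemma aR_pos (m : ℕ) : 0 < aR m := by
  unfold aR
  have : 0 < Gamma (1 + (m:ℝ) / 2) := Gamma_pos_of_pos (by positivity)
  positivity

lemma ray_moment (m : ℕ) : ∫⁻ x, ENNReal.ofReal (x ^ m) ∂rayleigh =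
    ENNReal.ofReal (aR m * m.factorial) := by
  rw [ray_lint _ (by fun_prop)]
  have hm : (0:ℝ) ≤ m := by positivity
  have h := integral_rpow_mul_exp_neg_mul_rpow (p := 2) (q := m + 1) (b := 1 / 2) two_pos
    (by linarith) (by norm_num)
  have hv : ((1:ℝ) / 2) ^ (-((m:ℝ) + 1 + 1) / 2) * (1 / 2) * Gamma ((m + 1 + 1) / 2) =
      aR m * m.factorial := by
    unfold aR
    rw [show ((m:ℝ) + 1 + 1) / 2 = 1 + m / 2 by ring,
      show -((m:ℝ) + 1 + 1) / 2 = -(m / 2 + 1) by ring, one_div, inv_rpow zero_le_two,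
      rpow_neg zero_le_two, inv_inv, rpow_add two_pos, rpow_one]
    have : (m.factorial : ℝ) ≠ 0 := by positivity
    field_simp
  rw [hv] at h
  have hpos : 0 < aR m * m.factorial := mul_pos (aR_pos m) (by positivity)
  rw [← h, ofReal_integral_eq_lintegral_ofReal]
  · refine setLIntegral_congr_fun measurableSet_Ioi fun x hx => ?_
    have hx : 0 < x := hx
    rw [← ENNReal.ofReal_mul (by positivity)]
    congr 1
    rw [rpow_add hx, rpow_natCast, rpow_one, rpow_two,
      show -x ^ 2 / 2 = -(1/2) * x ^ 2 by ring]
    ring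
  · exact Integrable.of_integral_ne_zero (by rw [h]; exact hpos.ne')
  · refine ae_restrict_of_forall_mem measurableSet_Ioi (fun x hx ↦ ?_)
    have hx : 0 < x := hx
    simp only [Pi.zero_apply]
    positivity

instance ray_prob : IsProbabilityMeasure rayleigh := by
  constructor
  have h := ray_moment 0
  simpa [aR] using h

lemma ray_mgl_ne_top (t : ℝ) : mgl rayleigh t ≠ ⊤ := by
  unfold mgl
  rw [ray_lint _ (by fun_prop)]
  have h : IntegrableOn (fun x : ℝ => x ^ (1:ℝ) * exp (-(1/4) * x ^ 2)) (Ioi 0) :=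
    (integrable_rpow_mul_exp_neg_mul_sq (by norm_num) (by norm_num)).integrableOn
  have h2 := (h.const_mul (exp (t ^ 2))).lintegral_lt_top
  refine ((lintegral_mono_ae ?_).trans_lt h2).ne
  refine ae_restrict_of_forall_mem measurableSet_Ioi (fun x hx ↦ ?_)
  have hx : 0 < x := hx
  rw [← ENNReal.ofReal_mul (by positivity)]
  apply ENNReal.ofReal_le_ofReal
  rw [rpow_one, mul_assoc, mul_left_comm (exp (t ^ 2)), ← exp_add, ← exp_add]
  refine mul_le_mul_of_nonneg_left (exp_le_exp.2 ?_) hx.le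
  nlinarith [sq_nonneg (t - x / 2)]

lemma exp_series {x : ℝ} (hx : 0 ≤ x) :
    ENNReal.ofReal (exp x) = ∑' m : ℕ, ENNReal.ofReal (x ^ m / m.factorial) := by
  rw [← ENNReal.ofReal_tsum_of_nonneg (fun m => by positivity) (Real.summable_pow_div_factorial x),
    Real.exp_eq_exp_ℝ, NormedSpace.exp_eq_tsum_div]

lemma ray_mgl {s : ℝ} (hs : 0 ≤ s) :
    mgl rayleigh s = ∑' m : ℕ, ENNReal.ofReal (aR m) * ENNReal.ofReal (s ^ m) := by
  unfold mgl
  have : ∫⁻ x, ENNReal.ofReal (exp (s * x)) ∂rayleigh =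
      ∫⁻ x, ∑' m : ℕ, ENNReal.ofReal (s ^ m / m.factorial) * ENNReal.ofReal (x ^ m) ∂rayleigh := by
    refine lintegral_congr_ae ?_
    filter_upwards [ray_ae] with x hx
    rw [exp_series (by positivity)]
    congr 1
    funext m
    rw [← ENNReal.ofReal_mul (by positivity), mul_pow]
    congr 1
    ring
  rw [this, lintegral_tsum (fun m => by fun_prop)]
  congr 1
  funext m
  rw [lintegral_const_mul _ (by fun_prop), ray_moment, ← ENNReal.ofReal_mul (by positivity),
    ← ENNReal.ofReal_mul (aR_pos m).le]
  congr 1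
  have : (m.factorial : ℝ) ≠ 0 := by positivity
  field_simp

/-- coefficient of pair moments -/
noncomputable def cD (a b : ℝ) : ℝ :=
  (2 * π)⁻¹ * (Gamma (a + 1 / 2) * Gamma (b + 1 / 2) * √π) / Gamma (a + b + 3 / 2)

lemma cD_nonneg {a b : ℝ} (ha : 0 ≤ a) (hb : 0 ≤ b) : 0 ≤ cD a b := by
  unfold cD
  have h1 : 0 < Gamma (a + 1 / 2) := Gamma_pos_of_pos (by positivity)
  have h2 : 0 < Gamma (b + 1 / 2) := Gamma_pos_of_pos (by positivity)
  have h3 : 0 < Gamma (a + b + 3 / 2) := Gamma_pos_of_pos (by positivity)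
  positivity

/-- `(δ, ε)` is distributed like a pair of coordinates of the Dirichlet law -/
def DPair (δ ε : ℝ × ℝ → ℝ) : Prop :=
  Measurable δ ∧ Measurable ε ∧ (∀ᵐ p ∂dirichletHalf, 0 < δ p ∧ 0 < ε p) ∧
    ∀ a b : ℝ, 0 ≤ a → 0 ≤ b →
      ∫⁻ p, ENNReal.ofReal (δ p ^ a * ε p ^ b) ∂dirichletHalf = ENNReal.ofReal (cD a b)

lemma dpair12 : DPair (fun p => p.1) (fun p => p.2) := by
  refine ⟨by fun_prop, by fun_prop, ?_, fun a b ha hb => ?_⟩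
  · filter_upwards [dirichlet_ae] with p hp using ⟨hp.1, hp.2.1⟩
  · have := dirichlet_moment ha hb le_rfl
    simp only [rpow_zero, mul_one, zero_add, Real.Gamma_one_half_eq, add_zero] at this
    rw [this, cD]

lemma dpair13 : DPair (fun p => p.1) (fun p => 1 - p.1 - p.2) := by
  refine ⟨by fun_prop, by fun_prop, ?_, fun a b ha hb => ?_⟩
  · filter_upwards [dirichlet_ae] with p hp using ⟨hp.1, by linarith [hp.2.2]⟩
  · have := dirichlet_moment ha le_rfl hb
    simp only [rpow_zero, mul_one, zero_add, Real.Gamma_one_half_eq, add_zero] at this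
    rw [this, cD]; congr 2; ring

lemma dpair23 : DPair (fun p => p.2) (fun p => 1 - p.1 - p.2) := by
  refine ⟨by fun_prop, by fun_prop, ?_, fun a b ha hb => ?_⟩
  · filter_upwards [dirichlet_ae] with p hp using ⟨hp.2.1, by linarith [hp.2.2]⟩
  · have := dirichlet_moment le_rfl ha hb
    simp only [rpow_zero, one_mul, zero_add, Real.Gamma_one_half_eq, add_zero] at this
    rw [this, cD]; congr 2; ring

lemma DPair.symm {δ ε} (h : DPair δ ε) : DPair ε δ := by
  obtain ⟨h1, h2, h3, h4⟩ := h
  refine ⟨h2, h1, h3.mono fun p hp => hp.symm, fun a b ha hb => ?_⟩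
  have := h4 b a hb ha
  simp_rw [mul_comm (ε _ ^ a), this, cD]
  congr 2
  · ring
  · ring_nf

lemma cD_zero {a : ℝ} (ha : 0 ≤ a) : cD a 0 = 1 / (2 * a + 1) := by
  unfold cD
  rw [show a + 0 + 3 / 2 = a + 1/2 + 1 by ring, Gamma_add_one (by positivity), zero_add,
    Real.Gamma_one_half_eq]
  have h1 : Gamma (a + 1 / 2) ≠ 0 := (Gamma_pos_of_pos (by positivity)).ne'
  have : √π * √π = π := Real.mul_self_sqrt pi_pos.le
  rw [mul_assoc, this]
  have h2 : a + 1/2 ≠ 0 := by positivity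
  have h3 : 2 * a + 1 ≠ 0 := by positivity
  field_simp

lemma sqrt_mul_pow {x t : ℝ} (hx : 0 ≤ x) (m : ℕ) : (√x * t) ^ m = t ^ m * x ^ ((m:ℝ) / 2) := by
  rw [mul_pow, Real.sqrt_eq_rpow, ← rpow_natCast (x ^ _), ← rpow_mul hx, mul_comm]
  congr 2
  ring

lemma termA {δ ε} (h : DPair δ ε) {t : ℝ} (ht : 0 ≤ t) :
    ∫⁻ p, ENNReal.ofReal (δ p ^ 2) * mgl rayleigh (√(δ p) * t) ∂dirichletHalf =
      ∑' m : ℕ, ENNReal.ofReal (t ^ m * (aR m / (m + 5))) := by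
  obtain ⟨h1, h2, h3, h4⟩ := h
  have : ∫⁻ p, ENNReal.ofReal (δ p ^ 2) * mgl rayleigh (√(δ p) * t) ∂dirichletHalf =
      ∫⁻ p, ∑' m : ℕ, ENNReal.ofReal (aR m * t ^ m) *
        ENNReal.ofReal (δ p ^ (2 + (m:ℝ) / 2) * ε p ^ (0:ℝ)) ∂dirichletHalf := by
    refine lintegral_congr_ae ?_
    filter_upwards [h3] with p hp
    rw [ray_mgl (by positivity), ← ENNReal.tsum_mul_left]
    congr 1
    funext m
    have := aR_pos m
    have := hp.1
    rw [← ENNReal.ofReal_mul (aR_pos m).le, ← ENNReal.ofReal_mul (by positivity),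
      ← ENNReal.ofReal_mul (by positivity), sqrt_mul_pow hp.1.le, rpow_zero, rpow_add hp.1, rpow_two]
    congr 1
    ring
  rw [this, lintegral_tsum (fun m => by fun_prop)]
  congr 1
  funext m
  have := aR_pos m
  rw [lintegral_const_mul _ (by fun_prop), h4 _ _ (by positivity) le_rfl, cD_zero (by positivity),
    ← ENNReal.ofReal_mul (by positivity)]
  congr 1
  field_simp
  ring

lemma ennreal_tsum_antidiag (f : ℕ → ℕ → ENNReal) :
    ∑' j, ∑' k, f j k = ∑' m, ∑ q ∈ Finset.HasAntidiagonal.antidiagonal m, f q.1 q.2 := by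
  rw [← ENNReal.tsum_prod, ← Finset.HasAntidiagonal.sigmaAntidiagonalEquivProd.tsum_eq, ENNReal.tsum_sigma']
  congr 1
  funext m
  rw [tsum_fintype]
  exact Finset.sum_coe_sort (Finset.HasAntidiagonal.antidiagonal m) (fun q => f q.1 q.2)

lemma termB {δ ε} (h : DPair δ ε) {t : ℝ} (ht : 0 ≤ t) :
    ∫⁻ p, 2 * ENNReal.ofReal (δ p * ε p) * (mgl rayleigh (√(δ p) * t) *
      mgl rayleigh (√(ε p) * t)) ∂dirichletHalf =
      ∑' m : ℕ, ENNReal.ofReal (t ^ m * ∑ q ∈ Finset.HasAntidiagonal.antidiagonal m,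
        2 * (aR q.1 * aR q.2 * cD (1 + q.1 / 2) (1 + q.2 / 2))) := by
  obtain ⟨h1, h2, h3, h4⟩ := h
  have : ∫⁻ p, 2 * ENNReal.ofReal (δ p * ε p) * (mgl rayleigh (√(δ p) * t) *
      mgl rayleigh (√(ε p) * t)) ∂dirichletHalf =
      ∫⁻ p, ∑' j : ℕ, ∑' k : ℕ, ENNReal.ofReal (2 * (aR j * aR k * t ^ j * t ^ k)) *
        ENNReal.ofReal (δ p ^ (1 + (j:ℝ) / 2) * ε p ^ (1 + (k:ℝ) / 2)) ∂dirichletHalf := by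
    refine lintegral_congr_ae ?_
    filter_upwards [h3] with p hp
    obtain ⟨hp1, hp2⟩ := hp
    rw [ray_mgl (by positivity), ray_mgl (by positivity), ← ENNReal.tsum_mul_right,
      ← ENNReal.tsum_mul_left]
    congr 1
    funext j
    rw [← ENNReal.tsum_mul_left, ← ENNReal.tsum_mul_left]
    congr 1
    funext k
    have := aR_pos j
    have := aR_pos k
    rw [show (2 : ENNReal) = ENNReal.ofReal 2 by simp,
      ← ENNReal.ofReal_mul (by positivity), ← ENNReal.ofReal_mul (by positivity),
      ← ENNReal.ofReal_mul (by positivity), ← ENNReal.ofReal_mul (by positivity),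
      ← ENNReal.ofReal_mul (by positivity), ← ENNReal.ofReal_mul (by positivity),
      sqrt_mul_pow hp1.le, sqrt_mul_pow hp2.le,
      rpow_add hp1, rpow_add hp2, rpow_one, rpow_one]
    congr 1
    ring
  rw [this, lintegral_tsum (fun m => by
    exact (Measurable.tsum (fun k => by fun_prop)).aemeasurable)]
  have : ∀ j : ℕ, ∫⁻ p, ∑' k : ℕ, ENNReal.ofReal (2 * (aR j * aR k * t ^ j * t ^ k)) *
        ENNReal.ofReal (δ p ^ (1 + (j:ℝ) / 2) * ε p ^ (1 + (k:ℝ) / 2)) ∂dirichletHalf =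
      ∑' k : ℕ, ENNReal.ofReal (2 * (aR j * aR k * t ^ j * t ^ k) *
        cD (1 + j / 2) (1 + k / 2)) := by
    intro j
    rw [lintegral_tsum (fun m => by fun_prop)]
    congr 1
    funext k
    have := aR_pos j
    have := aR_pos k
    rw [lintegral_const_mul _ (by fun_prop), h4 _ _ (by positivity) (by positivity),
      ← ENNReal.ofReal_mul (by positivity)]
  simp_rw [this]
  rw [ennreal_tsum_antidiag]
  congr 1
  funext m
  rw [← ENNReal.ofReal_sum_of_nonneg, Finset.mul_sum]
  · congr 1
    refine Finset.sum_congr rfl fun q hq => ?_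
    rw [← Finset.HasAntidiagonal.mem_antidiagonal.1 hq, pow_add]
    ring
  · intro q _
    have := aR_pos q.1
    have := aR_pos q.2
    have := cD_nonneg (a := 1 + (q.1:ℝ) / 2) (b := 1 + (q.2:ℝ) / 2) (by positivity) (by positivity)
    positivity

lemma aR_gamma (m : ℕ) : aR m * Gamma ((m:ℝ) / 2 + 3 / 2) =
    2 ^ (-(m:ℝ) / 2) * √π * (m + 1) / 2 := by
  unfold aR
  have h := Real.Gamma_mul_Gamma_add_half ((m:ℝ) / 2 + 1 / 2)
  rw [show (m:ℝ) / 2 + 1/2 + 1/2 = 1 + m / 2 by ring,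
    show 2 * ((m:ℝ) / 2 + 1/2) = m + 1 by ring, Real.Gamma_nat_eq_factorial,
    show (1:ℝ) - (m + 1) = -(m / 2) + -(m / 2) by ring, rpow_add two_pos] at h
  rw [show (m:ℝ) / 2 + 3/2 = m / 2 + 1/2 + 1 by ring, Gamma_add_one (by positivity),
    show -(m:ℝ) / 2 = -(m / 2) by ring]
  have h2 : (2:ℝ) ^ ((m:ℝ) / 2) * 2 ^ (-((m:ℝ) / 2)) = 1 := by
    rw [← rpow_add two_pos]; simp
  have h3 : (m.factorial : ℝ) ≠ 0 := by positivity
  rw [div_mul_eq_mul_div, div_eq_iff h3]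
  linear_combination (2:ℝ) ^ ((m:ℝ) / 2) * ((m + 1) / 2) * h +
    (m.factorial * 2 ^ (-((m:ℝ) / 2)) * √π * ((m + 1) / 2)) * h2

lemma sum_antidiag (m : ℕ) :
    ∑ q ∈ Finset.HasAntidiagonal.antidiagonal m, ((q.1:ℝ) + 1) * (q.2 + 1) = (m + 1) * (m + 2) * (m + 3) / 6 := by
  have h : ∀ n : ℕ, ∀ N : ℝ, ∑ k ∈ Finset.range n, ((k:ℝ) + 1) * (N - k + 1) =
      (N + 2) * (n * (n + 1) / 2) - n * (n + 1) * (2 * n + 1) / 6 := by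
    intro n N
    induction n with
    | zero => simp
    | succ n ih => rw [Finset.sum_range_succ, ih]; push_cast; ring
  rw [Finset.Nat.sum_antidiagonal_eq_sum_range_succ (fun j k : ℕ => ((j:ℝ) + 1) * (k + 1))]
  have : ∑ k ∈ Finset.range m.succ, ((k:ℝ) + 1) * (((m - k : ℕ) : ℝ) + 1) =
      ∑ k ∈ Finset.range (m + 1), ((k:ℝ) + 1) * ((m:ℝ) - k + 1) := by
    refine Finset.sum_congr rfl fun k hk => ?_
    rw [Nat.cast_sub (by have := Finset.mem_range.1 hk; omega)]
  rw [this, h]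
  push_cast
  ring

lemma coeff_identity (m : ℕ) :
    3 * (aR m / (m + 5)) + 3 * ∑ q ∈ Finset.HasAntidiagonal.antidiagonal m,
        2 * (aR q.1 * aR q.2 * cD (1 + q.1 / 2) (1 + q.2 / 2)) = aR m := by
  have hS : ∑ q ∈ Finset.HasAntidiagonal.antidiagonal m,
        2 * (aR q.1 * aR q.2 * cD (1 + q.1 / 2) (1 + q.2 / 2)) =
      ∑ q ∈ Finset.HasAntidiagonal.antidiagonal m, (√π / (4 * Gamma ((m:ℝ) / 2 + 7 / 2)) * 2 ^ (-(m:ℝ) / 2)) *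
        (((q.1:ℝ) + 1) * (q.2 + 1)) := by
    refine Finset.sum_congr rfl fun q hq => ?_
    have hm : (m:ℝ) = q.1 + q.2 := by
      rw [← Finset.HasAntidiagonal.mem_antidiagonal.1 hq]; push_cast; ring
    have e1 := aR_gamma q.1
    have e2 := aR_gamma q.2
    unfold cD
    rw [show (1:ℝ) + q.1 / 2 + 1/2 = q.1 / 2 + 3/2 by ring,
      show (1:ℝ) + q.2 / 2 + 1/2 = q.2 / 2 + 3/2 by ring,
      show (1:ℝ) + q.1 / 2 + (1 + q.2 / 2) + 3/2 = m / 2 + 7/2 by rw [hm]; ring]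
    have hp : (2:ℝ) ^ (-(m:ℝ) / 2) = 2 ^ (-(q.1:ℝ) / 2) * 2 ^ (-(q.2:ℝ) / 2) := by
      rw [← rpow_add two_pos, hm]; congr 1; ring
    have h7 : Gamma ((m:ℝ) / 2 + 7 / 2) ≠ 0 := (Gamma_pos_of_pos (by positivity)).ne'
    have hpi : √π * √π = π := Real.mul_self_sqrt pi_pos.le
    calc _ = (π⁻¹ * √π / Gamma ((m:ℝ) / 2 + 7 / 2)) * ((aR q.1 * Gamma ((q.1:ℝ) / 2 + 3 / 2)) *
          (aR q.2 * Gamma ((q.2:ℝ) / 2 + 3 / 2))) := by field_simp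
      _ = (π⁻¹ * (√π * √π)) * (√π / (4 * Gamma ((m:ℝ) / 2 + 7 / 2)) *
            (2 ^ (-(q.1:ℝ) / 2) * 2 ^ (-(q.2:ℝ) / 2)) * (((q.1:ℝ) + 1) * (q.2 + 1))) := by
          rw [e1, e2]
          field_simp
          ring
      _ = _ := by
          rw [hp, hpi, inv_mul_cancel₀ pi_ne_zero, one_mul]
  rw [hS, ← Finset.mul_sum, sum_antidiag,
    show (m:ℝ) / 2 + 7/2 = m / 2 + 3/2 + 1 + 1 by ring, Gamma_add_one (by positivity),
    Gamma_add_one (by positivity)]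
  have e := aR_gamma m
  have hg : Gamma ((m:ℝ) / 2 + 3 / 2) ≠ 0 := (Gamma_pos_of_pos (by positivity)).ne'
  have e' : √π * 2 ^ (-(m:ℝ) / 2) = 2 * (aR m * Gamma ((m:ℝ) / 2 + 3 / 2)) / (m + 1) := by
    rw [e]
    field_simp
  rw [div_mul_eq_mul_div, e']
  have h5 : (m:ℝ) + 5 ≠ 0 := by positivity
  have h3 : (m:ℝ) / 2 + 3/2 + 1 ≠ 0 := by positivity
  have h4 : (m:ℝ) / 2 + 3/2 ≠ 0 := by positivity
  have h6 : (m:ℝ) + 1 ≠ 0 := by positivity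
  rw [show (m:ℝ) / 2 + 3/2 + 1 = (m + 5) / 2 by ring]
  have h8 : (m:ℝ) + 3 ≠ 0 := by positivity
  rw [show (m:ℝ) / 2 + 3/2 = (m + 3) / 2 by ring] at hg ⊢
  field_simp
  ring

open MeasureTheory Real Set
open Filter Topology

lemma mgl_zero (μ : Measure ℝ) [IsProbabilityMeasure μ] : mgl μ 0 = 1 := by
  simp [mgl]

lemma six_sum {T A S c : ℝ} (hT : 0 ≤ T) (hA : 0 ≤ A) (hS : 0 ≤ S) (hc : 0 ≤ c)
    (h : 3 * A + 3 * S = c) :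
    ENNReal.ofReal (T * A) + ENNReal.ofReal (T * A) + ENNReal.ofReal (T * A) +
      ENNReal.ofReal (T * S) + ENNReal.ofReal (T * S) + ENNReal.ofReal (T * S) =
    ENNReal.ofReal c * ENNReal.ofReal T := by
  have hTA : 0 ≤ T * A := mul_nonneg hT hA
  have hTS : 0 ≤ T * S := mul_nonneg hT hS
  generalize hX : T * A = X at *
  generalize hY : T * S = Y at *
  rw [← ENNReal.ofReal_mul hc, ← ENNReal.ofReal_add hTA hTA,
    ← ENNReal.ofReal_add (by positivity) hTA, ← ENNReal.ofReal_add (by positivity) hTS,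
    ← ENNReal.ofReal_add (by positivity) hTS, ← ENNReal.ofReal_add (by positivity) hTS]
  congr 1
  subst hX hY h
  ring

lemma Fsm_ray_mgl {t : ℝ} (ht : 0 ≤ t) : mgl (Fsm rayleigh) t = mgl rayleigh t := by
  rw [Fsm_mgl, omg_lint (fun a b c => mgl rayleigh (a * t) * mgl rayleigh (b * t) *
    mgl rayleigh (c * t)) (by fun_prop)]
  simp only [zero_mul, mgl_zero, mul_one, one_mul]
  rw [lintegral_add_left (by fun_prop), lintegral_add_left (by fun_prop),
    lintegral_add_left (by fun_prop), lintegral_add_left (by fun_prop),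
    lintegral_add_left (by fun_prop), termA dpair12 ht, termA dpair12.symm ht,
    termA dpair13.symm ht, termB dpair12 ht, termB dpair13 ht, termB dpair23 ht,
    ← ENNReal.tsum_add, ← ENNReal.tsum_add, ← ENNReal.tsum_add, ← ENNReal.tsum_add,
    ← ENNReal.tsum_add, ray_mgl ht]
  congr 1
  funext m
  have h1 := aR_pos m
  have h2 : 0 ≤ ∑ q ∈ Finset.HasAntidiagonal.antidiagonal m,
        2 * (aR q.1 * aR q.2 * cD (1 + q.1 / 2) (1 + q.2 / 2)) := by
    refine Finset.sum_nonneg fun q _ => ?_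
    have := aR_pos q.1
    have := aR_pos q.2
    have := cD_nonneg (a := 1 + (q.1:ℝ) / 2) (b := 1 + (q.2:ℝ) / 2) (by positivity) (by positivity)
    positivity
  have h3 := coeff_identity m
  exact six_sum (pow_nonneg ht m) (by positivity) h2 h1.le h3

lemma ray_mgl_le_one {s : ℝ} (hs : s ≤ 0) : mgl rayleigh s ≤ 1 := by
  unfold mgl
  have : ∫⁻ x, ENNReal.ofReal (exp (s * x)) ∂rayleigh ≤ ∫⁻ x, 1 ∂rayleigh := by
    refine lintegral_mono_ae ?_
    filter_upwards [ray_ae] with x hx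
    rw [ENNReal.ofReal_le_one, exp_le_one_iff]
    exact mul_nonpos_of_nonpos_of_nonneg hs hx.le
  simpa using this

lemma Fsm_ray_mgl_ne_top (t : ℝ) : mgl (Fsm rayleigh) t ≠ ⊤ := by
  rcases le_total 0 t with ht | ht
  · rw [Fsm_ray_mgl ht]; exact ray_mgl_ne_top t
  · rw [Fsm_mgl]
    have : ∫⁻ w, mgl rayleigh (wT1 w * t) * mgl rayleigh (wT2 w * t) * mgl rayleigh (wT3 w * t) ∂omg
        ≤ ∫⁻ w, 1 ∂omg := by
      refine lintegral_mono fun w => ?_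
      obtain ⟨h1, h2, h3⟩ := wT_nonneg w
      refine mul_le_one' (mul_le_one' (ray_mgl_le_one ?_) (ray_mgl_le_one ?_)) (ray_mgl_le_one ?_)
      all_goals exact mul_nonpos_of_nonneg_of_nonpos (by assumption) ht
    refine (this.trans_lt ?_).ne
    simp

lemma integrableExpSet_univ (μ : Measure ℝ) (h : ∀ t, mgl μ t ≠ ⊤) :
    ProbabilityTheory.integrableExpSet id μ = univ := by
  ext t
  simp only [ProbabilityTheory.integrableExpSet, mem_ofPred_eq, mem_univ, iff_true, id]
  refine ⟨by fun_prop, ?_⟩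
  rw [hasFiniteIntegral_iff_ofReal (Filter.Eventually.of_forall fun x => (exp_pos _).le)]
  exact (h t).lt_top

lemma mgf_eq_mgl (μ : Measure ℝ) (t : ℝ) : ProbabilityTheory.mgf id μ t = (mgl μ t).toReal := by
  unfold ProbabilityTheory.mgf mgl
  rw [integral_eq_lintegral_of_nonneg_ae (Filter.Eventually.of_forall fun x => (exp_pos _).le)
    (by fun_prop)]
  simp

lemma Fsm_ray : Fsm rayleigh = rayleigh := by
  apply Measure.ext_of_complexMGF_id_eq
  have a1 : AnalyticOnNhd ℂ (ProbabilityTheory.complexMGF id (Fsm rayleigh)) univ := by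
    have := ProbabilityTheory.analyticOnNhd_complexMGF (X := id) (μ := Fsm rayleigh)
    simpa [integrableExpSet_univ _ Fsm_ray_mgl_ne_top] using this
  have a2 : AnalyticOnNhd ℂ (ProbabilityTheory.complexMGF id rayleigh) univ := by
    have := ProbabilityTheory.analyticOnNhd_complexMGF (X := id) (μ := rayleigh)
    simpa [integrableExpSet_univ _ ray_mgl_ne_top] using this
  refine a1.eq_of_frequently_eq a2 (z₀ := 0) ?_
  have hs : Tendsto (fun n : ℕ => (((1 / ((n:ℝ) + 1) : ℝ)) : ℂ)) atTop (𝓝[≠] 0) := by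
    rw [tendsto_nhdsWithin_iff]
    constructor
    · have := (Complex.continuous_ofReal.tendsto 0).comp
        (tendsto_one_div_add_atTop_nhds_zero_nat (𝕜 := ℝ))
      rw [Complex.ofReal_zero] at this
      exact this
    · refine Filter.Eventually.of_forall fun n => ?_
      simp only [mem_compl_iff, mem_singleton_iff, Complex.ofReal_eq_zero]
      positivity
  refine hs.frequently (Filter.Eventually.of_forall fun n => ?_).frequently
  rw [ProbabilityTheory.complexMGF_ofReal, ProbabilityTheory.complexMGF_ofReal, mgf_eq_mgl,
    mgf_eq_mgl, Fsm_ray_mgl (by positivity)]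

lemma wmomA {δ ε} (h : DPair δ ε) (r : ℕ) :
    ∫⁻ p, ENNReal.ofReal (δ p ^ 2) * ENNReal.ofReal (√(δ p) ^ r) ∂dirichletHalf =
      ENNReal.ofReal (cD (2 + r / 2) 0) := by
  obtain ⟨h1, h2, h3, h4⟩ := h
  rw [← h4 _ _ (by positivity) le_rfl]
  refine lintegral_congr_ae ?_
  filter_upwards [h3] with p hp
  have := sqrt_mul_pow (t := 1) hp.1.le r
  rw [mul_one, one_pow, one_mul] at this
  rw [← ENNReal.ofReal_mul (by positivity), this, rpow_zero, rpow_add hp.1, rpow_two, mul_one]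

lemma wmomB {δ ε} (h : DPair δ ε) (r : ℕ) :
    ∫⁻ p, 2 * ENNReal.ofReal (δ p * ε p) * ENNReal.ofReal (√(δ p) ^ r + √(ε p) ^ r)
      ∂dirichletHalf = ENNReal.ofReal (4 * cD (1 + r / 2) 1) := by
  have e2 := h.symm.2.2.2 (1 + r / 2) 1 (by positivity) zero_le_one
  obtain ⟨h1, h2, h3, h4⟩ := h
  have e1 := h4 (1 + r / 2) 1 (by positivity) zero_le_one
  have hc : 0 ≤ cD (1 + r / 2) 1 := cD_nonneg (by positivity) zero_le_one
  have : ENNReal.ofReal (4 * cD (1 + r / 2) 1) =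
      2 * ENNReal.ofReal (cD (1 + r / 2) 1) + 2 * ENNReal.ofReal (cD (1 + r / 2) 1) := by
    rw [ENNReal.ofReal_mul (by norm_num), ← add_mul]
    congr 1
    norm_num
  rw [this]
  nth_rw 1 [← e1]
  rw [← e2, ← lintegral_const_mul _ (by fun_prop), ← lintegral_const_mul _ (by fun_prop),
    ← lintegral_add_left (by fun_prop)]
  refine lintegral_congr_ae ?_
  filter_upwards [h3] with p hp
  have k1 := sqrt_mul_pow (t := 1) hp.1.le r
  have k2 := sqrt_mul_pow (t := 1) hp.2.le r
  rw [mul_one, one_pow, one_mul] at k1 k2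
  obtain ⟨hp1, hp2⟩ := hp
  rw [k1, k2, ← mul_add, mul_assoc, ← ENNReal.ofReal_mul (by positivity),
    ← ENNReal.ofReal_add (by positivity) (by positivity), rpow_add hp1, rpow_add hp2, rpow_one,
    rpow_one]
  congr 2
  ring

lemma wmom (r : ℕ) (hr : r ≠ 0) :
    ∫⁻ w, ENNReal.ofReal (wT1 w ^ r + wT2 w ^ r + wT3 w ^ r) ∂omg =
      ENNReal.ofReal (3 * cD (2 + r / 2) 0 + 12 * cD (1 + r / 2) 1) := by
  rw [omg_lint (fun a b c => ENNReal.ofReal (a ^ r + b ^ r + c ^ r)) (by fun_prop)]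
  simp only [zero_pow hr, add_zero, zero_add]
  rw [lintegral_add_left (by fun_prop), lintegral_add_left (by fun_prop),
    lintegral_add_left (by fun_prop), lintegral_add_left (by fun_prop),
    lintegral_add_left (by fun_prop), wmomA dpair12, wmomA dpair12.symm,
    wmomA dpair13.symm, wmomB dpair12, wmomB dpair13, wmomB dpair23]
  have h1 : 0 ≤ cD (1 + r / 2) 1 := cD_nonneg (by positivity) zero_le_one
  have h2 : 0 ≤ cD (2 + r / 2) 0 := cD_nonneg (by positivity) le_rfl
  rw [← ENNReal.ofReal_add (by positivity) (by positivity),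
    ← ENNReal.ofReal_add (by positivity) (by positivity),
    ← ENNReal.ofReal_add (by positivity) (by positivity),
    ← ENNReal.ofReal_add (by positivity) (by positivity),
    ← ENNReal.ofReal_add (by positivity) (by positivity)]
  congr 1
  ring

lemma gamma_three_half : Gamma (3 / 2) = √π / 2 := by
  rw [show (3 / 2 : ℝ) = 1/2 + 1 by norm_num, Gamma_add_one (by norm_num), Real.Gamma_one_half_eq]
  ring

lemma wmom1 : ∫⁻ w, ENNReal.ofReal (wT1 w ^ 1 + wT2 w ^ 1 + wT3 w ^ 1) ∂omg = ENNReal.ofReal 1 := by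
  rw [wmom 1 one_ne_zero, cD_zero (by positivity)]
  congr 1
  unfold cD
  rw [show (1 + ((1:ℕ):ℝ) / 2 + 1/2) = ((1:ℕ):ℝ) + 1 by norm_num,
    show (1 + ((1:ℕ):ℝ) / 2 + 1 + 3/2) = ((3:ℕ):ℝ) + 1 by norm_num, Real.Gamma_nat_eq_factorial,
    Real.Gamma_nat_eq_factorial, show (1:ℝ) + 1/2 = 3/2 by norm_num, gamma_three_half]
  have : √π * √π = π := Real.mul_self_sqrt pi_pos.le
  have e : (((1:ℕ).factorial : ℝ) * (√π / 2) * √π) = π / 2 := by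
    simp; linear_combination this / 2
  rw [e]
  simp [Nat.factorial]
  field_simp
  norm_num

lemma wmom2 : ∫⁻ w, ENNReal.ofReal (wT1 w ^ 2 + wT2 w ^ 2 + wT3 w ^ 2) ∂omg =
    ENNReal.ofReal (27 / 35) := by
  rw [wmom 2 two_ne_zero, cD_zero (by positivity)]
  congr 1
  unfold cD
  rw [show (1 + ((2:ℕ):ℝ) / 2 + 1/2) = 5/2 by norm_num,
    show (1 + ((2:ℕ):ℝ) / 2 + 1 + 3/2) = 5/2 + 1 + 1 by norm_num, Gamma_add_one (by norm_num),
    Gamma_add_one (by norm_num), show (1:ℝ) + 1/2 = 3/2 by norm_num, gamma_three_half]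
  have : √π * √π = π := Real.mul_self_sqrt pi_pos.le
  have e : (Gamma (5/2) * (√π / 2) * √π) = π / 2 * Gamma (5/2) := by
    linear_combination Gamma (5/2) * this / 2
  have hg : Gamma (5/2) ≠ 0 := (Gamma_pos_of_pos (by norm_num)).ne'
  rw [e]
  push_cast
  field_simp
  norm_num

lemma wint (r : ℕ) (c : ℝ) (hc : 0 ≤ c)
    (h : ∫⁻ w, ENNReal.ofReal (wT1 w ^ r + wT2 w ^ r + wT3 w ^ r) ∂omg = ENNReal.ofReal c) :
    Integrable (fun w => wT1 w ^ r + wT2 w ^ r + wT3 w ^ r) omg ∧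
    ∫ w, wT1 w ^ r + wT2 w ^ r + wT3 w ^ r ∂omg = c := by
  have hn : ∀ w, 0 ≤ wT1 w ^ r + wT2 w ^ r + wT3 w ^ r := by
    intro w
    obtain ⟨h1, h2, h3⟩ := wT_nonneg w
    positivity
  refine ⟨⟨by fun_prop, ?_⟩, ?_⟩
  · rw [hasFiniteIntegral_iff_ofReal (Filter.Eventually.of_forall hn), h]
    exact ENNReal.ofReal_lt_top
  · rw [integral_eq_lintegral_of_nonneg_ae (Filter.Eventually.of_forall hn) (by fun_prop), h,
      ENNReal.toReal_ofReal hc]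

lemma prod_diff {a b c a' b' c' : ℂ} (hb : ‖b‖ ≤ 1) (hc : ‖c‖ ≤ 1)
    (ha' : ‖a'‖ ≤ 1) (hb' : ‖b'‖ ≤ 1) :
    ‖a * b * c - a' * b' * c'‖ ≤ ‖a - a'‖ + ‖b - b'‖ + ‖c - c'‖ := by
  have e : a * b * c - a' * b' * c' = (a - a') * (b * c) + a' * (b - b') * c + a' * b' * (c - c') := by
    ring
  rw [e]
  refine (norm_add₃_le).trans ?_
  simp only [norm_mul]
  gcongr
  · exact mul_le_of_le_one_right (norm_nonneg _) (mul_le_one₀ hb (norm_nonneg _) hc)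
  · calc ‖a'‖ * ‖b - b'‖ * ‖c‖ ≤ 1 * ‖b - b'‖ * 1 := by gcongr
      _ = _ := by ring
  · calc ‖a'‖ * ‖b'‖ * ‖c - c'‖ ≤ 1 * 1 * ‖c - c'‖ := by gcongr
      _ = _ := by ring

lemma contract (μ : Measure ℝ) [IsProbabilityMeasure μ] {ε C : ℝ}
    (h : ∀ t, ‖charFun μ t - charFun rayleigh t‖ ≤ ε * |t| + C * t ^ 2) (t : ℝ) :
    ‖charFun (Fsm μ) t - charFun rayleigh t‖ ≤ ε * |t| + (C * (27 / 35)) * t ^ 2 := by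
  have hI : ∀ (ν : Measure ℝ) [IsProbabilityMeasure ν], Integrable (fun w =>
      charFun ν (wT1 w * t) * charFun ν (wT2 w * t) * charFun ν (wT3 w * t)) omg := by
    intro ν _
    have hm : Measurable (charFun ν) := measurable_charFun
    refine (integrable_const (1:ℝ)).mono' (by fun_prop) (Filter.Eventually.of_forall fun q => ?_)
    rw [norm_mul, norm_mul]
    exact mul_le_one₀ (mul_le_one₀ (norm_charFun_le_one _) (norm_nonneg _) (norm_charFun_le_one _))
      (norm_nonneg _) (norm_charFun_le_one _)
  conv_lhs => rw [← Fsm_ray]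
  rw [Fsm_charFun, Fsm_charFun, ← integral_sub (hI μ) (hI rayleigh)]
  obtain ⟨i1, v1⟩ := wint 1 1 zero_le_one wmom1
  obtain ⟨i2, v2⟩ := wint 2 (27 / 35) (by norm_num) wmom2
  have hb : ∫ w, ε * |t| * (wT1 w ^ 1 + wT2 w ^ 1 + wT3 w ^ 1) +
      C * t ^ 2 * (wT1 w ^ 2 + wT2 w ^ 2 + wT3 w ^ 2) ∂omg =
      ε * |t| + (C * (27 / 35)) * t ^ 2 := by
    rw [integral_add (i1.const_mul _) (i2.const_mul _), integral_const_mul, integral_const_mul, v1, v2]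
    ring
  rw [← hb]
  refine norm_integral_le_of_norm_le ((i1.const_mul _).add (i2.const_mul _))
    (Filter.Eventually.of_forall fun w => ?_)
  refine (prod_diff (norm_charFun_le_one _) (norm_charFun_le_one _) (norm_charFun_le_one _)
    (norm_charFun_le_one _)).trans ?_
  obtain ⟨n1, n2, n3⟩ := wT_nonneg w
  refine (add_le_add (add_le_add (h _) (h _)) (h _)).trans (le_of_eq ?_)
  rw [abs_mul, abs_mul, abs_mul, abs_of_nonneg n1, abs_of_nonneg n2, abs_of_nonneg n3]
  ring

lemma ray_mean : ∫ x, x ∂rayleigh = √(π / 2) := by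
  rw [integral_eq_lintegral_of_nonneg_ae (ray_ae.mono fun x hx => hx.le) (by fun_prop)]
  have h := ray_moment 1
  simp only [pow_one] at h
  rw [h, ENNReal.toReal_ofReal (by have := aR_pos 1; positivity), aR,
    show (1:ℝ) + ((1:ℕ):ℝ) / 2 = 3/2 by norm_num, gamma_three_half]
  simp only [Nat.cast_one, Nat.factorial_one, div_one, mul_one]
  rw [← Real.sqrt_eq_rpow, Real.sqrt_div pi_pos.le]
  have : √2 * √2 = 2 := Real.mul_self_sqrt zero_le_two
  field_simp
  linear_combination this

lemma charFun_deriv (μ : Measure ℝ) [IsProbabilityMeasure μ] (h : ∫ x, x ∂μ = √(π / 2)) :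
    HasDerivAt (charFun μ) (Complex.I * (√(π / 2) : ℝ)) 0 := by
  have hi : Integrable id μ := Integrable.of_integral_ne_zero (by
    simp only [id]; rw [h]; positivity)
  have hL : MemLp id ((1:ℕ):ENNReal) μ := by
    simpa using memLp_one_iff_integrable.2 hi
  have h1 := iteratedDeriv_charFun_zero hL
  rw [iteratedDeriv_one] at h1
  simp only [pow_one] at h1
  have hd : DifferentiableAt ℝ (charFun μ) 0 :=
    ((contDiff_charFun hL).differentiable (by simp)) 0
  have := hd.hasDerivAt
  rw [h1] at this
  rwa [h] at this

lemma initial_bound (μ : Measure ℝ) [IsProbabilityMeasure μ] (h : ∫ x, x ∂μ = √(π / 2))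
    {ε : ℝ} (hε : 0 < ε) : ∃ C : ℝ, 0 ≤ C ∧
      ∀ t, ‖charFun μ t - charFun rayleigh t‖ ≤ ε * |t| + C * t ^ 2 := by
  have hd := (charFun_deriv μ h).sub (charFun_deriv rayleigh ray_mean)
  rw [sub_self, hasDerivAt_iff_isLittleO_nhds_zero] at hd
  have hb := hd.bound hε
  obtain ⟨δ, hδ, hb⟩ := Metric.eventually_nhds_iff.1 hb
  refine ⟨2 / δ ^ 2, by positivity, fun t => ?_⟩
  by_cases ht : dist t 0 < δ
  · have := hb ht
    simp only [zero_add, Pi.sub_apply, charFun_zero, smul_zero, sub_zero, probReal_univ, sub_self,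
      Real.norm_eq_abs] at this
    refine this.trans ?_
    have : 0 ≤ 2 / δ ^ 2 * t ^ 2 := by positivity
    linarith
  · rw [Real.dist_eq, sub_zero, not_lt] at ht
    have h2 : ‖charFun μ t - charFun rayleigh t‖ ≤ 2 := by
      refine (norm_sub_le _ _).trans ?_
      have := norm_charFun_le_one (μ := μ) t
      have := norm_charFun_le_one (μ := rayleigh) t
      linarith
    have h3 : 2 ≤ 2 / δ ^ 2 * t ^ 2 := by
      rw [div_mul_eq_mul_div, le_div_iff₀ (by positivity), ← sq_abs t]
      gcongr
    have : 0 ≤ ε * |t| := by positivity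
    linarith

instance iter_prob (μ : Measure ℝ) [IsProbabilityMeasure μ] (n : ℕ) :
    IsProbabilityMeasure (Fsm^[n] μ) := by
  induction n with
  | zero => simpa
  | succ n ih => rw [Function.iterate_succ_apply']; infer_instance

lemma charFun_tendsto (μ : Measure ℝ) [IsProbabilityMeasure μ] (h : ∫ x, x ∂μ = √(π / 2)) (t : ℝ) :
    Tendsto (fun n => charFun (Fsm^[n] μ) t) atTop (𝓝 (charFun rayleigh t)) := by
  rw [Metric.tendsto_atTop]
  intro η hη
  have hε : 0 < η / (2 * (|t| + 1)) := by positivity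
  obtain ⟨C, hC, hb⟩ := initial_bound μ h hε
  have hn : ∀ n : ℕ, ∀ s, ‖charFun (Fsm^[n] μ) s - charFun rayleigh s‖ ≤
      η / (2 * (|t| + 1)) * |s| + C * (27 / 35) ^ n * s ^ 2 := by
    intro n
    induction n with
    | zero => simpa using hb
    | succ n ih =>
      intro s
      rw [Function.iterate_succ_apply', pow_succ, ← mul_assoc]
      exact contract _ ih s
  have hlim : Tendsto (fun n : ℕ => C * (27 / 35 : ℝ) ^ n * t ^ 2) atTop (𝓝 (C * 0 * t ^ 2)) :=
    ((tendsto_pow_atTop_nhds_zero_of_lt_one (by norm_num) (by norm_num)).const_mul C).mul_const _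
  rw [mul_zero, zero_mul] at hlim
  obtain ⟨N, hN⟩ := Filter.eventually_atTop.1 (hlim.eventually_lt_const (half_pos hη))
  refine ⟨N, fun n hnN => ?_⟩
  rw [dist_eq_norm]
  refine (hn n t).trans_lt ?_
  have h1 : η / (2 * (|t| + 1)) * |t| ≤ η / 2 := by
    rw [div_mul_eq_mul_div, div_le_div_iff₀ (by positivity) two_pos]
    nlinarith [abs_nonneg t]
  linarith [hN n hnN]

/-- Attractiveness of the Rayleigh fixed point: if `μ₀` is a Borel probability measure
on `[0,∞)` with mean `√(π/2)`, then the iterates `𝔉_sm^n μ₀` converge weakly to the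
Rayleigh distribution. -/
theorem smoothing_iterates_converge_to_rayleigh (μ₀ : Measure ℝ)
    [IsProbabilityMeasure μ₀] (hsupp : μ₀ (Set.Iio 0) = 0)
    (hmean : ∫ x, x ∂μ₀ = Real.sqrt (π / 2)) :
    ∀ f : BoundedContinuousFunction ℝ ℝ,
      Tendsto (fun n => ∫ x, f x ∂(Fsm^[n] μ₀)) atTop (𝓝 (∫ x, f x ∂rayleigh)) := by
  let P : ℕ → ProbabilityMeasure ℝ := fun n => ⟨Fsm^[n] μ₀, inferInstance⟩
  let R : ProbabilityMeasure ℝ := ⟨rayleigh, inferInstance⟩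
  have h : Tendsto P atTop (𝓝 R) :=
    ProbabilityMeasure.tendsto_of_tendsto_charFun fun t => charFun_tendsto μ₀ hmean t
  exact ProbabilityMeasure.tendsto_iff_forall_integral_tendsto.1 h
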